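/- Let η = (η_0, …, η_N) ∈ ℂ^{N+1} and let Θ(η) be the associated upper-left triangular Hankel matrix. Then Θ(η) Θ(η)^* − Z Θ(η) Θ(η)^* Z^* = η η^*, where η η^* is the rank-one matrix with (j,k) entry η_j·conj(η_k). -/

import Mathlib

open Matrix Finset

/-- Multiplying by the upper shift matrix moves the rows of a matrix up by one. -/
theorem shift_mul_apply {N : ℕ} {ι R : Type*} [NonAssocSemiring R]
    {Z : Matrix (Fin (N + 1)) (Fin (N + 1)) R}
    (hZ : ∀ j k : Fin (N + 1), Z j k = if (k : ℕ) = (j : ℕ) + 1 then 1 else 0)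
    (A : Matrix (Fin (N + 1)) ι R) (j : Fin (N + 1)) (k : ι) :
    (Z * A) j k = if h : (j : ℕ) + 1 < N + 1 then A ⟨(j : ℕ) + 1, h⟩ k else 0 := by
  simp only [Matrix.mul_apply, hZ, ite_mul, one_mul, zero_mul]
  split_ifs with h
  · rw [Finset.sum_eq_single ⟨(j : ℕ) + 1, h⟩]
    · simp
    · intro m _ hm
      exact if_neg fun h' => hm (Fin.ext h')
    · simp
  · exact Finset.sum_eq_zero fun m _ => if_neg (by omega)

/-- **Displacement identity for upper-left triangular Hankel matrices.**
`Θ(η) Θ(η)ᴴ − Z Θ(η) Θ(η)ᴴ Zᴴ = η ηᴴ`. -/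
theorem hankel_displacement_rank_one
    (N : ℕ) (η : Fin (N + 1) → ℂ)
    (Θ : Matrix (Fin (N + 1)) (Fin (N + 1)) ℂ)
    (hΘ : ∀ j k : Fin (N + 1),
      Θ j k = if h : (j : ℕ) + (k : ℕ) ≤ N then η ⟨(j : ℕ) + (k : ℕ), Nat.lt_succ_of_le h⟩ else 0)
    (Z : Matrix (Fin (N + 1)) (Fin (N + 1)) ℂ)
    (hZ : ∀ j k : Fin (N + 1), Z j k = if (k : ℕ) = (j : ℕ) + 1 then 1 else 0) :
    Θ * Θᴴ - Z * (Θ * Θᴴ) * Zᴴ = Matrix.vecMulVec η (fun k => (starRingEnd ℂ) (η k)) := by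
  let f : ℕ → ℂ := fun n => if h : n < N + 1 then η ⟨n, h⟩ else 0
  have hf : ∀ n, N < n → f n = 0 := fun n hn => dif_neg (by omega)
  have hfη : ∀ j : Fin (N + 1), f j = η j := fun j => dif_pos j.isLt
  have hΘf : ∀ j k : Fin (N + 1), Θ j k = f (j + k) := by
    intro j k
    simp only [hΘ, f, Nat.lt_succ_iff]
  have hZΘ : ∀ j k : Fin (N + 1), (Z * Θ) j k = f (j + (k + 1)) := by
    intro j k
    rw [shift_mul_apply hZ]
    split_ifs with h
    · rw [hΘf]
      congr 1
      simp only
      omega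
    · exact (hf _ (by omega)).symm
  have hassoc : Z * (Θ * Θᴴ) * Zᴴ = (Z * Θ) * (Z * Θ)ᴴ := by
    simp only [Matrix.conjTranspose_mul, Matrix.mul_assoc]
  ext j l
  rw [hassoc, Matrix.sub_apply, Matrix.mul_apply, Matrix.mul_apply, ← Finset.sum_sub_distrib]
  simp only [Matrix.conjTranspose_apply, hΘf, hZΘ]
  rw [Fin.sum_univ_eq_sum_range
    (fun k => f (j + k) * star (f (l + k)) - f (j + (k + 1)) * star (f (l + (k + 1)))) (N + 1),
    Finset.sum_range_sub' (fun k => f (j + k) * star (f (l + k))),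
    hf (j + (N + 1)) (by omega)]
  simp [Matrix.vecMulVec_apply, hfη]
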